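/- arXiv:math/0412318 — 2 statements merged into one kernel-verified Lean document; each statement's English description precedes it below -/
import Mathlib

section
/- Let T be a finite-dimensional real vector space, F ⊆ T a subspace, L ⊆ T × T* a maximal isotropic subspace for the canonical symmetric form, and H := H(L, F) = { Z ∈ T : there exists α ∈ ann F with (Z, α) ∈ L }. Assume T = H ⊕ F (L is F-coupling). Then: (a) L = (L ∩ (H × ann F)) ⊕ (L ∩ (F × ann H)); (b) L ∩ ({0} × ann F) = {0} and L ∩ (F × {0}) = {0}; (c) for every X ∈ H there is a unique α ∈ ann F with (X, α) ∈ L, and σ(X, X') := α(X') (for (X, α) ∈ L ∩ (H × ann F), X' ∈ H) is a well-defined skew-symmetric bilinear form on H; (d) for every λ ∈ ann H there is a unique Y ∈ F with (Y, λ) ∈ L, and Π(λ, μ) := μ(Y) (for (Y, λ) ∈ L ∩ (F × ann H), μ ∈ ann H) is a well-defined skew-symmetric bilinear form on ann H. -/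
/-- The canonical symmetric pairing `g((X,α),(Y,β)) = (1/2)(β(X) + α(Y))` on `T × T*`. -/
noncomputable def cpair {T : Type*} [AddCommGroup T] [Module ℝ T]
    (p q : T × Module.Dual ℝ T) : ℝ :=
  (1/2 : ℝ) * (q.2 p.1 + p.2 q.1)

/-- A subspace of `T × T*` is isotropic if the canonical pairing vanishes on it. -/
def IsIsotropic {T : Type*} [AddCommGroup T] [Module ℝ T]
    (L : Submodule ℝ (T × Module.Dual ℝ T)) : Prop :=
  ∀ p ∈ L, ∀ q ∈ L, cpair p q = 0

/-- `H(L, F) = {Z : ∃ α ∈ ann F, (Z, α) ∈ L}`. -/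
def couplingH {T : Type*} [AddCommGroup T] [Module ℝ T]
    (L : Submodule ℝ (T × Module.Dual ℝ T)) (F : Submodule ℝ T) : Submodule ℝ T :=
  Submodule.map (LinearMap.fst ℝ T (Module.Dual ℝ T))
    (L ⊓ Submodule.prod ⊤ F.dualAnnihilator)

section Coupling

variable {T : Type*} [AddCommGroup T] [Module ℝ T]
  {F : Submodule ℝ T} {L : Submodule ℝ (T × Module.Dual ℝ T)}

theorem cpair_eq_zero_iff {p q : T × Module.Dual ℝ T} :
    cpair p q = 0 ↔ q.2 p.1 + p.2 q.1 = 0 := by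
  simp [cpair]

theorem IsIsotropic.apply_add_apply_eq_zero (hiso : IsIsotropic L) {X Y : T}
    {α β : Module.Dual ℝ T} (hX : (X, α) ∈ L) (hY : (Y, β) ∈ L) : β X + α Y = 0 :=
  cpair_eq_zero_iff.1 (hiso _ hX _ hY)

theorem mem_couplingH {Z : T} :
    Z ∈ couplingH L F ↔ ∃ α ∈ F.dualAnnihilator, (Z, α) ∈ L := by
  simp [couplingH, and_comm]

/-- A null vector orthogonal to a maximal isotropic subspace belongs to it. -/
theorem mem_of_maximal_isotropic (hiso : IsIsotropic L)
    (hmax : ∀ L' : Submodule ℝ (T × Module.Dual ℝ T), IsIsotropic L' → L ≤ L' → L' = L)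
    {X : T} {α : Module.Dual ℝ T} (hnull : α X = 0)
    (horth : ∀ Y β, (Y, β) ∈ L → β X + α Y = 0) : (X, α) ∈ L := by
  have hsup : IsIsotropic (L ⊔ Submodule.span ℝ {(X, α)}) := by
    intro p hp q hq
    obtain ⟨⟨Y, β⟩, hY, v, hv, rfl⟩ := Submodule.mem_sup.1 hp
    obtain ⟨⟨Z, γ⟩, hZ, w, hw, rfl⟩ := Submodule.mem_sup.1 hq
    obtain ⟨a, rfl⟩ := Submodule.mem_span_singleton.1 hv
    obtain ⟨b, rfl⟩ := Submodule.mem_span_singleton.1 hw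
    have hYZ := hiso.apply_add_apply_eq_zero hY hZ
    have hXY := horth Y β hY
    have hXZ := horth Z γ hZ
    rw [cpair_eq_zero_iff]
    simp only [Prod.smul_mk, Prod.mk_add_mk, LinearMap.add_apply, LinearMap.smul_apply,
      map_add, map_smul, smul_eq_mul]
    linear_combination hYZ + b * hXY + a * hXZ + 2 * a * b * hnull
  rw [← hmax _ hsup le_sup_left]
  exact Submodule.mem_sup_right (Submodule.mem_span_singleton_self _)

theorem IsIsotropic.eq_zero_of_zero_mk_mem (hiso : IsIsotropic L)
    (hcpl : IsCompl (couplingH L F) F) {α : Module.Dual ℝ T}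
    (hα : α ∈ F.dualAnnihilator) (h : ((0 : T), α) ∈ L) : α = 0 := by
  ext Z
  obtain ⟨Z₁, hZ₁, Z₂, hZ₂, rfl⟩ :=
    Submodule.mem_sup.1 (hcpl.sup_eq_top ▸ Submodule.mem_top (x := Z))
  obtain ⟨β, -, hβ⟩ := mem_couplingH.1 hZ₁
  have h₁ := hiso.apply_add_apply_eq_zero h hβ
  have h₂ := (Submodule.mem_dualAnnihilator _).1 hα Z₂ hZ₂
  simpa [h₂] using h₁

theorem eq_zero_of_mk_zero_mem (hcpl : IsCompl (couplingH L F) F) {Y : T} (hY : Y ∈ F)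
    (h : (Y, (0 : Module.Dual ℝ T)) ∈ L) : Y = 0 :=
  Submodule.disjoint_def.1 hcpl.disjoint Y (mem_couplingH.2 ⟨0, zero_mem _, h⟩) hY

/-- Elements of an isotropic coupling subspace split along `H × ann F` and `F × ann H`. -/
theorem IsIsotropic.exists_coupling_decomposition (hiso : IsIsotropic L)
    (hcpl : IsCompl (couplingH L F) F) {p : T × Module.Dual ℝ T} (hp : p ∈ L) :
    ∃ q ∈ L ⊓ (couplingH L F).prod F.dualAnnihilator,
      ∃ r ∈ L ⊓ F.prod (couplingH L F).dualAnnihilator, q + r = p := by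
  obtain ⟨X, α⟩ := p
  obtain ⟨Z, hZ, Y, hY, rfl⟩ :=
    Submodule.mem_sup.1 (hcpl.sup_eq_top ▸ Submodule.mem_top (x := X))
  obtain ⟨β, hβF, hβ⟩ := mem_couplingH.1 hZ
  have hr : (Y, α - β) ∈ L := by simpa using L.sub_mem hp hβ
  refine ⟨(Z, β), ⟨hβ, hZ, hβF⟩, (Y, α - β), ⟨hr, hY, ?_⟩, by simp⟩
  refine (Submodule.mem_dualAnnihilator _).2 fun W hW => ?_
  obtain ⟨γ, hγF, hγ⟩ := mem_couplingH.1 hW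
  have h := hiso.apply_add_apply_eq_zero hr hγ
  rwa [(Submodule.mem_dualAnnihilator _).1 hγF Y hY, zero_add] at h

theorem exists_mem_of_mem_dualAnnihilator_couplingH [FiniteDimensional ℝ T]
    (hiso : IsIsotropic L)
    (hmax : ∀ L' : Submodule ℝ (T × Module.Dual ℝ T), IsIsotropic L' → L ≤ L' → L' = L)
    (hcpl : IsCompl (couplingH L F) F) {lam : Module.Dual ℝ T}
    (hlam : lam ∈ (couplingH L F).dualAnnihilator) : ∃ Y ∈ F, (Y, lam) ∈ L := by
  let W : Submodule ℝ (Module.Dual ℝ T) :=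
    (L ⊓ F.prod (couplingH L F).dualAnnihilator).map (LinearMap.snd ℝ T (Module.Dual ℝ T))
  have hW : W.dualCoannihilator ≤ couplingH L F := by
    intro X hX
    obtain ⟨Z, hZ, Y, hY, rfl⟩ :=
      Submodule.mem_sup.1 (hcpl.sup_eq_top ▸ Submodule.mem_top (x := X))
    have hYL : (Y, (0 : Module.Dual ℝ T)) ∈ L := by
      refine mem_of_maximal_isotropic hiso hmax rfl fun V β hV => ?_
      obtain ⟨⟨A, γ⟩, ⟨-, -, hγ⟩, ⟨B, δ⟩, hr, hsum⟩ :=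
        hiso.exists_coupling_decomposition hcpl hV
      have hδX := (Submodule.mem_dualCoannihilator _).1 hX δ ⟨(B, δ), hr, rfl⟩
      have hδZ : δ Z = 0 := (Submodule.mem_dualAnnihilator _).1 hr.2.2 Z hZ
      have hγY : γ Y = 0 := (Submodule.mem_dualAnnihilator _).1 hγ Y hY
      obtain rfl : γ + δ = β := congrArg Prod.snd hsum
      simpa [hγY, hδZ] using hδX
    rw [eq_zero_of_mk_zero_mem hcpl hY hYL, add_zero]
    exact hZ
  have hmem := Submodule.dualAnnihilator_anti hW hlam
  rw [Subspace.dualCoannihilator_dualAnnihilator_eq] at hmem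
  obtain ⟨⟨Y, mu⟩, ⟨hL, hY, -⟩, rfl⟩ := hmem
  exact ⟨Y, hY, hL⟩

end Coupling

/-- Let `L ⊆ T × T*` be maximal isotropic and `F`-coupling, i.e.
`T = H ⊕ F` for `H = H(L, F)`.  Then: (a) `L = (L ∩ (H × ann F)) ⊕ (L ∩ (F × ann H))`;
(b) `L ∩ ({0} × ann F) = 0` and `L ∩ (F × {0}) = 0`; (c) every `X ∈ H` has a unique
`α ∈ ann F` with `(X, α) ∈ L`, and `σ(X, X') = α(X')` is a well-defined skew-symmetric
form on `H`; (d) every `λ ∈ ann H` has a unique `Y ∈ F` with `(Y, λ) ∈ L`, and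
`Π(λ, μ) = μ(Y)` is a well-defined skew-symmetric form on `ann H`. -/
theorem stmt14 {T : Type*} [AddCommGroup T] [Module ℝ T] [FiniteDimensional ℝ T]
    (F : Submodule ℝ T)
    (L : Submodule ℝ (T × Module.Dual ℝ T))
    (hiso : IsIsotropic L)
    (hmax : ∀ L' : Submodule ℝ (T × Module.Dual ℝ T), IsIsotropic L' → L ≤ L' → L' = L)
    (hcpl : IsCompl (couplingH L F) F) :
    -- (a)
    ((L ⊓ ((couplingH L F).prod F.dualAnnihilator)) ⊔
        (L ⊓ (F.prod (couplingH L F).dualAnnihilator)) = L ∧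
      (L ⊓ ((couplingH L F).prod F.dualAnnihilator)) ⊓
        (L ⊓ (F.prod (couplingH L F).dualAnnihilator)) = ⊥) ∧
    -- (b)
    (∀ α ∈ F.dualAnnihilator, ((0 : T), α) ∈ L → α = 0) ∧
    (∀ Y ∈ F, (Y, (0 : Module.Dual ℝ T)) ∈ L → Y = 0) ∧
    -- (c)
    (∀ X ∈ couplingH L F, ∃! α : Module.Dual ℝ T, α ∈ F.dualAnnihilator ∧ (X, α) ∈ L) ∧
    (∀ (X X' : T) (α α' : Module.Dual ℝ T), (X, α) ∈ L → α ∈ F.dualAnnihilator →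
      (X', α') ∈ L → α' ∈ F.dualAnnihilator → α X' = - α' X) ∧
    -- (d)
    (∀ lam ∈ (couplingH L F).dualAnnihilator, ∃! Y : T, Y ∈ F ∧ (Y, lam) ∈ L) ∧
    (∀ (Y Y' : T) (lam mu : Module.Dual ℝ T),
      (Y, lam) ∈ L → Y ∈ F → lam ∈ (couplingH L F).dualAnnihilator →
      (Y', mu) ∈ L → Y' ∈ F → mu ∈ (couplingH L F).dualAnnihilator →
      mu Y = - lam Y') := by
  refine ⟨⟨le_antisymm (sup_le inf_le_left inf_le_left) fun p hp =>
      Submodule.mem_sup.2 (hiso.exists_coupling_decomposition hcpl hp), ?_⟩,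
    fun α hα h => hiso.eq_zero_of_zero_mk_mem hcpl hα h,
    fun Y hY h => eq_zero_of_mk_zero_mem hcpl hY h, fun X hX => ?_,
    fun X X' α α' hX _ hX' _ => ?_, fun lam hlam => ?_,
    fun Y Y' lam mu hY _ _ hY' _ _ => ?_⟩
  · rw [Submodule.eq_bot_iff]
    rintro ⟨X, α⟩ ⟨⟨hL, hXH, hαF⟩, -, hXF, -⟩
    obtain rfl : X = 0 := Submodule.disjoint_def.1 hcpl.disjoint X hXH hXF
    exact Prod.ext rfl (hiso.eq_zero_of_zero_mk_mem hcpl hαF hL)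
  · obtain ⟨α, hαF, hα⟩ := mem_couplingH.1 hX
    refine ⟨α, ⟨hαF, hα⟩, fun β hβ => sub_eq_zero.1 ?_⟩
    exact hiso.eq_zero_of_zero_mk_mem hcpl (sub_mem hβ.1 hαF)
      (by simpa using L.sub_mem hβ.2 hα)
  · linear_combination hiso.apply_add_apply_eq_zero hX hX'
  · obtain ⟨Y, hYF, hY⟩ := exists_mem_of_mem_dualAnnihilator_couplingH hiso hmax hcpl hlam
    refine ⟨Y, ⟨hYF, hY⟩, fun Z hZ => sub_eq_zero.1 ?_⟩
    exact eq_zero_of_mk_zero_mem hcpl (sub_mem hZ.1 hYF)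
      (by simpa using L.sub_mem hZ.2 hY)
  · linear_combination hiso.apply_add_apply_eq_zero hY hY'
end

section
/- Let T be a finite-dimensional real vector space, F ⊆ T a subspace, and L ⊆ T × T* a maximal isotropic subspace for the canonical symmetric form which is F-coupling, i.e. T = H ⊕ F for H := H(L, F). Then every (X, α) ∈ L with X ∈ F satisfies α ∈ ann H; that is, { (X, α) ∈ L : X ∈ F } = L ∩ (F × ann H). -/
/-- If `L ⊆ T × T*` is maximal isotropic and `F`-coupling
(`T = H ⊕ F` for `H = H(L, F)`), then every `(X, α) ∈ L` with `X ∈ F` has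
`α ∈ ann H`; i.e. `{(X, α) ∈ L : X ∈ F} = L ∩ (F × ann H)`. -/
theorem stmt19 {T : Type*} [AddCommGroup T] [Module ℝ T] [FiniteDimensional ℝ T]
    (F : Submodule ℝ T)
    (L : Submodule ℝ (T × Module.Dual ℝ T))
    (hiso : IsIsotropic L)
    (hmax : ∀ L' : Submodule ℝ (T × Module.Dual ℝ T), IsIsotropic L' → L ≤ L' → L' = L)
    (hcpl : IsCompl (couplingH L F) F) :
    ∀ (X : T) (α : Module.Dual ℝ T), (X, α) ∈ L → X ∈ F →
      α ∈ (couplingH L F).dualAnnihilator := by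
  intro X α hXα hXF
  rw [Submodule.mem_dualAnnihilator]
  rintro _ ⟨⟨Z, β⟩, ⟨hZβ, -, hβ⟩, rfl⟩
  have hpair := hiso _ hXα _ hZβ
  have hβX : β X = 0 := (Submodule.mem_dualAnnihilator β).1 hβ X hXF
  simpa [cpair, hβX] using hpair
end
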